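/- Sober spaces form the epireflective hull of the Sierpiński space in the category of T0 topological spaces, in the following concrete form: a T0 topological space X is sober if and only if there exist an index type I and a topological embedding of X into the product space I → Prop (the I-fold power of the Sierpiński space with the product topology) whose image is b-closed in the product. -/

import Mathlib

/-- The b-closure of a subset `M` of a topological space: the set of points `y` such that
any two open sets agreeing on `M` cannot separate `y`. -/
def bClosure {Y : Type*} [TopologicalSpace Y] (M : Set Y) : Set Y :=
  {y : Y | ∀ U V : Set Y, IsOpen U → IsOpen V → U ∩ M = V ∩ M → (y ∈ U ↔ y ∈ V)}

open Topology

universe u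

instance quasiSober_prop : QuasiSober Prop where
  sober {S} hS hS' := by
    by_cases h : True ∈ S
    · refine ⟨True, (hS'.closure_subset_iff.2 (by simpa using h)).antisymm fun p _ ↦ ?_⟩
      rw [← specializes_iff_mem_closure, Specializes, nhds_true]
      by_cases hp : p <;> simp [hp]
    · have hS_eq : S = {False} := by
        refine hS.nonempty.subset_singleton_iff.1 fun p hp ↦ ?_
        by_cases hp' : p <;> simp_all
      exact ⟨False, by rw [IsGenericPoint, ← hS_eq, hS'.closure_eq]⟩

instance quasiSober_pi {ι : Type*} {Y : ι → Type*} [∀ i, TopologicalSpace (Y i)]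
    [∀ i, QuasiSober (Y i)] : QuasiSober (∀ i, Y i) where
  sober {S} hS hS' := by
    classical
    have hproj (i : ι) : IsIrreducible (Function.eval i '' S) :=
      hS.image _ (continuous_apply i).continuousOn
    choose y hy using fun i ↦ QuasiSober.sober (hproj i).closure isClosed_closure
    refine ⟨y, (hS'.closure_subset_iff.2 ?_).antisymm fun s hs ↦ ?_⟩
    · rw [Set.singleton_subset_iff, ← hS'.closure_eq, mem_closure_iff]
      intro U hU hyU
      obtain ⟨J, u, hu, hJU⟩ := isOpen_pi_iff.1 hU y hyU
      obtain ⟨s, hsS, hs⟩ := isIrreducible_iff_sInter.1 hS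
        (J.image fun i ↦ Function.eval i ⁻¹' u i)
        (by
          simp only [Finset.mem_image]
          rintro _ ⟨i, hi, rfl⟩
          exact (hu i hi).1.preimage (continuous_apply i))
        (by
          simp only [Finset.mem_image]
          rintro _ ⟨i, hi, rfl⟩
          obtain ⟨_, ht, s, hs, rfl⟩ := mem_closure_iff.1 (hy i).mem _ (hu i hi).1 (hu i hi).2
          exact ⟨s, hs, ht⟩)
      refine ⟨s, hJU fun i hi ↦ ?_, hsS⟩
      exact hs _ (Finset.mem_coe.2 (Finset.mem_image_of_mem _ hi))
    · rw [← specializes_iff_mem_closure, specializes_pi]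
      exact fun i ↦ (hy i).specializes (subset_closure ⟨s, hs, rfl⟩)

theorem subset_bClosure {Y : Type*} [TopologicalSpace Y] (M : Set Y) : M ⊆ bClosure M := by
  intro y hy U V _ _ h
  simpa [hy] using Set.ext_iff.1 h y

theorem IsOpen.exists_mem_closure_singleton_of_mem_bClosure {Y : Type*} [TopologicalSpace Y]
    {M U : Set Y} (hU : IsOpen U) {y : Y} (hy : y ∈ bClosure M) (hyU : y ∈ U) :
    ∃ m ∈ M, m ∈ U ∧ m ∈ closure {y} := by
  by_contra! h
  have hU' : U ∩ M = (U ∩ (closure {y})ᶜ) ∩ M := by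
    ext m
    simpa using fun hmM hm ↦ h m hmM hm
  exact ((hy _ _ hU (hU.inter isClosed_closure.isOpen_compl) hU').1 hyU).2
    (subset_closure rfl)

theorem Topology.IsInducing.quasiSober_of_bClosure_range_subset {X Y : Type*}
    [TopologicalSpace X] [TopologicalSpace Y] [QuasiSober Y] {e : X → Y} (he : IsInducing e)
    (h : bClosure (Set.range e) ⊆ Set.range e) : QuasiSober X where
  sober {S} hS hS' := by
    obtain ⟨y, hy⟩ := QuasiSober.sober
      (hS.image e he.continuous.continuousOn).closure isClosed_closure
    have key {U : Set Y} (hU : IsOpen U) : y ∈ U ↔ ∃ x ∈ S, e x ∈ U := by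
      rw [hy.mem_open_set_iff hU, closure_inter_open_nonempty_iff hU]
      simp [Set.Nonempty]
    obtain ⟨x, rfl⟩ : y ∈ Set.range e := by
      refine h fun U V hU hV hUV ↦ ?_
      have hUV' (x : X) : e x ∈ U ↔ e x ∈ V := by simpa using Set.ext_iff.1 hUV (e x)
      simp_rw [key hU, key hV, hUV']
    refine ⟨x, ?_⟩
    rw [IsGenericPoint, he.closure_eq_preimage_closure_image, Set.image_singleton, hy.def,
      ← he.closure_eq_preimage_closure_image, hS'.closure_eq]

theorem Topology.IsInducing.bClosure_range {X Y : Type*} [TopologicalSpace X]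
    [TopologicalSpace Y] [QuasiSober X] [T0Space Y] {e : X → Y} (he : IsInducing e) :
    bClosure (Set.range e) = Set.range e := by
  refine (subset_bClosure _).antisymm' fun y hy ↦ ?_
  have key {U : Set Y} (hU : IsOpen U) : (e ⁻¹' closure {y} ∩ e ⁻¹' U).Nonempty ↔ y ∈ U := by
    refine ⟨fun ⟨x, hx, hxU⟩ ↦ (specializes_iff_mem_closure.2 hx).mem_open hU hxU, fun hyU ↦ ?_⟩
    obtain ⟨_, ⟨x, rfl⟩, hxU, hx⟩ := hU.exists_mem_closure_singleton_of_mem_bClosure hy hyU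
    exact ⟨x, hx, hxU⟩
  have hS : IsIrreducible (e ⁻¹' closure {y}) := by
    refine ⟨by simpa using key isOpen_univ, fun U V hU hV hSU hSV ↦ ?_⟩
    obtain ⟨U', hU', rfl⟩ := he.isOpen_iff.1 hU
    obtain ⟨V', hV', rfl⟩ := he.isOpen_iff.1 hV
    exact (key (hU'.inter hV')).2 ⟨(key hU').1 hSU, (key hV').1 hSV⟩
  obtain ⟨x, hx⟩ := QuasiSober.sober hS (isClosed_closure.preimage he.continuous)
  refine ⟨x, Inseparable.eq (inseparable_iff_forall_isOpen.2 fun U hU ↦ ?_)⟩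
  rw [← key hU, ← hx.mem_open_set_iff (hU.preimage he.continuous), Set.mem_preimage]

/-- Sober spaces form the epireflective hull of the Sierpiński space in the category of T0
spaces: a T0 topological space `X` is sober if and only if there exist an index type `I` and
a topological embedding of `X` into the `I`-fold power `I → Prop` of the Sierpiński space
whose image is b-closed in the product. -/
theorem sober_iff_embeds_bClosed_in_power (X : Type u) [TopologicalSpace X] [T0Space X] :
    (T0Space X ∧ QuasiSober X) ↔
      ∃ (I : Type u) (e : X → I → Prop),
        IsEmbedding e ∧ bClosure (Set.range e) = Set.range e := by
  refine ⟨fun ⟨_, _⟩ ↦ ?_, fun ⟨I, e, he, h⟩ ↦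
    ⟨inferInstance, he.isInducing.quasiSober_of_bClosure_range_subset h.subset⟩⟩
  have he := TopologicalSpace.productOfMemOpens_isEmbedding X
  exact ⟨_, _, he, he.isInducing.bClosure_range⟩
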